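/- arXiv:2009.12059 — 2 statements merged into one kernel-verified Lean document; each statement's English description precedes it below -/
import Mathlib

section
/- Two signed graphs (G,σ) and (H,π) are isomorphic (as signed graphs) if and only if their double switching graphs (Ĝ,σ̂) and (Ĥ,π̂) are sp-isomorphic. -/
open SimpleGraph

/-- A signed graph: a simple graph together with a symmetric sign function on
ordered pairs of vertices (`true` = positive, `false` = negative); only the values
on adjacent pairs are relevant. -/
structure SignedGraph (V : Type) where
  G : SimpleGraph V
  sign : V → V → Bool
  sign_symm : ∀ u v : V, sign u v = sign v u

namespace SignedGraph

variable {V W : Type}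

/-- The sign of a walk: `true` iff it traverses an even number of negative edges
(counted with multiplicity). -/
def walkSign (S : SignedGraph V) {u v : V} (w : S.G.Walk u v) : Bool :=
  (w.darts.map fun d => S.sign d.toProd.1 d.toProd.2).foldr (· == ·) true

/-- `SwitchEquiv S T` : `T` is obtained from `S` by switching a set of vertices
(encoded by `s : V → Bool`). -/
def SwitchEquiv (S T : SignedGraph V) : Prop :=
  S.G = T.G ∧ ∃ s : V → Bool, ∀ u v : V, S.G.Adj u v →
    T.sign u v = ((s u == s v) == S.sign u v)

/-- A sign-preserving homomorphism. -/
def IsSpHom (S : SignedGraph V) (T : SignedGraph W) (f : V → W) : Prop :=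
  ∀ u v : V, S.G.Adj u v →
    T.G.Adj (f u) (f v) ∧ T.sign (f u) (f v) = S.sign u v

/-- A homomorphism of signed graphs: maps edges to edges and preserves the signs of
closed walks. -/
def IsHom (S : SignedGraph V) (T : SignedGraph W) (f : V → W) : Prop :=
  ∃ hadj : ∀ u v : V, S.G.Adj u v → T.G.Adj (f u) (f v),
    ∀ (u : V) (w : S.G.Walk u u),
      T.walkSign (w.map ⟨f, fun {a b} h => hadj a b h⟩) = S.walkSign w

/-- A sign-preserving isomorphism. -/
def IsSpIso (S : SignedGraph V) (T : SignedGraph W) (f : V → W) : Prop :=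
  Function.Bijective f ∧ IsSpHom S T f ∧
    ∃ g : W → V, Function.LeftInverse g f ∧ Function.RightInverse g f ∧ IsSpHom T S g

/-- An isomorphism of signed graphs. -/
def IsIso (S : SignedGraph V) (T : SignedGraph W) (f : V → W) : Prop :=
  Function.Bijective f ∧ IsHom S T f ∧
    ∃ g : W → V, Function.LeftInverse g f ∧ Function.RightInverse g f ∧ IsHom T S g

/-- The sign-preserving chromatic number. -/
noncomputable def chromSp (S : SignedGraph V) : ℕ :=
  sInf {n : ℕ | ∃ T : SignedGraph (Fin n), ∃ f : V → Fin n, IsSpHom S T f}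

/-- The signed chromatic number. -/
noncomputable def chromS (S : SignedGraph V) : ℕ :=
  sInf {n : ℕ | ∃ T : SignedGraph (Fin n), ∃ f : V → Fin n, IsHom S T f}

/-- The double switching graph of a signed graph. -/
def doubleSwitch (S : SignedGraph V) : SignedGraph (V × Bool) where
  G := { Adj := fun p q => S.G.Adj p.1 q.1
         symm := ⟨fun p q h => S.G.symm.symm _ _ h⟩
         loopless := ⟨fun p h => S.G.loopless.irrefl p.1 h⟩ }
  sign := fun p q => ((p.2 == q.2) == S.sign p.1 q.1)
  sign_symm := by
    rintro ⟨p1, p2⟩ ⟨q1, q2⟩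
    have := S.sign_symm p1 q1
    cases p2 <;> cases q2 <;> simp [this]

end SignedGraph

/-- `G` has a complete minor on `n` branch sets: there are `n` nonempty, pairwise
disjoint vertex sets, each inducing a connected subgraph, with an edge of `G`
between any two of them. -/
def SimpleGraph.HasCompleteMinor {V : Type} (G : SimpleGraph V) (n : ℕ) : Prop :=
  ∃ B : Fin n → Set V,
    (∀ i, (B i).Nonempty) ∧
    (∀ i, (G.induce (B i)).Connected) ∧
    (∀ i j, i ≠ j → Disjoint (B i) (B j)) ∧
    (∀ i j, i ≠ j → ∃ u ∈ B i, ∃ v ∈ B j, G.Adj u v)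



namespace SignedGraph

variable {V W : Type}

theorem walkSign_nil (S : SignedGraph V) (u : V) :
    S.walkSign (Walk.nil : S.G.Walk u u) = true := rfl

theorem walkSign_cons (S : SignedGraph V) {u v w : V} (h : S.G.Adj u v) (p : S.G.Walk v w) :
    S.walkSign (Walk.cons h p) = (S.sign u v == S.walkSign p) := rfl

theorem walkSign_append (S : SignedGraph V) {u v w : V} (p : S.G.Walk u v) (q : S.G.Walk v w) :
    S.walkSign (p.append q) = (S.walkSign p == S.walkSign q) := by
  induction p with
  | nil => simp [walkSign_nil]
  | cons h p ih =>
    rw [Walk.cons_append, walkSign_cons, walkSign_cons, ih]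
    cases S.sign _ _ <;> cases S.walkSign p <;> cases S.walkSign q <;> rfl

theorem walkSign_reverse (S : SignedGraph V) {u v : V} (p : S.G.Walk u v) :
    S.walkSign p.reverse = S.walkSign p := by
  induction p with
  | nil => simp [walkSign_nil]
  | @cons a b c h p ih =>
    rw [Walk.reverse_cons, walkSign_append, walkSign_cons, walkSign_cons, ih, walkSign_nil,
      S.sign_symm b a]
    cases S.sign a b <;> cases S.walkSign p <;> rfl

/-- A map that preserves signs up to switching is a homomorphism. -/
theorem isHom_of_switch (S : SignedGraph V) (T : SignedGraph W) (f : V → W) (s : V → Bool)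
    (hadj : ∀ u v, S.G.Adj u v → T.G.Adj (f u) (f v))
    (hs : ∀ u v, S.G.Adj u v → T.sign (f u) (f v) = ((s u == s v) == S.sign u v)) :
    IsHom S T f := by
  refine ⟨hadj, ?_⟩
  have key : ∀ (u v : V) (w : S.G.Walk u v),
      T.walkSign (w.map ⟨f, fun {a b} h => hadj a b h⟩) = ((s u == s v) == S.walkSign w) := by
    intro u v w
    induction w with
    | nil => simp [walkSign_nil]
    | @cons a b c h p ih =>
      rw [Walk.map_cons, walkSign_cons, walkSign_cons, ih]
      have := hs a b h
      simp only [RelHom.coeFn_mk]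
      rw [this]
      cases s a <;> cases s b <;> cases s c <;> cases S.sign a b <;> cases S.walkSign p <;> rfl
  intro u w
  rw [key]
  simp

/-- A homomorphism preserves signs up to switching. -/
theorem exists_switch_of_isHom (S : SignedGraph V) (T : SignedGraph W) (f : V → W)
    (hf : IsHom S T f) :
    ∃ s : V → Bool, ∀ u v, S.G.Adj u v →
      T.sign (f u) (f v) = ((s u == s v) == S.sign u v) := by
  obtain ⟨hadj, hw⟩ := hf
  have hroot : ∃ root : V → V, (∀ u v, S.G.Adj u v → root u = root v) ∧
      ∀ v, Nonempty (S.G.Walk (root v) v) := by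
    refine ⟨fun v => (S.G.connectedComponentMk v).out, ?_, ?_⟩
    · intro u v h
      have : S.G.connectedComponentMk u = S.G.connectedComponentMk v :=
        ConnectedComponent.sound h.reachable
      simp only [this]
    · intro v
      exact ConnectedComponent.exact (Quot.out_eq (S.G.connectedComponentMk v))
  obtain ⟨root, hr, hwalk⟩ := hroot
  have key : ∀ (a b u v : V) (p : S.G.Walk a u) (q : S.G.Walk b v), a = b → S.G.Adj u v →
      T.sign (f u) (f v) =
        (((T.walkSign (p.map ⟨f, fun {a b} h => hadj a b h⟩) == S.walkSign p) ==
          (T.walkSign (q.map ⟨f, fun {a b} h => hadj a b h⟩) == S.walkSign q)) ==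
          S.sign u v) := by
    intro a b u v p q hab h
    subst hab
    have := hw a (p.append (Walk.cons h q.reverse))
    rw [Walk.map_append, Walk.map_cons, ← Walk.reverse_map, walkSign_append, walkSign_append,
      walkSign_cons, walkSign_cons, walkSign_reverse, walkSign_reverse] at this
    simp only [RelHom.coeFn_mk] at this
    revert this
    generalize T.walkSign (p.map _) = x1
    generalize T.walkSign (q.map _) = x2
    generalize S.walkSign p = x3
    generalize S.walkSign q = x4
    generalize S.sign u v = x5
    generalize T.sign _ _ = x6
    revert x1 x2 x3 x4 x5 x6
    decide
  exact ⟨fun v => T.walkSign ((hwalk v).some.map ⟨f, fun {a b} h => hadj a b h⟩) ==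
    S.walkSign (hwalk v).some, fun u v h => key _ _ u v _ _ (hr u v h) h⟩

/-- Hall: a bijection between doubled sets induces a transversal injection. -/
theorem exists_transversal [Fintype V] [Fintype W] (g : V × Bool → W × Bool)
    (hg : Function.Injective g) :
    ∃ f : V → W, Function.Injective f ∧ ∀ v, ∃ i j, g (v, i) = (f v, j) := by
  classical
  let t : V → Finset W := fun v => {(g (v, false)).1, (g (v, true)).1}
  have hall : ∀ s : Finset V, s.card ≤ (s.biUnion t).card := by
    intro s
    have h1 : (s ×ˢ (Finset.univ : Finset Bool)).image g ⊆
        (s.biUnion t) ×ˢ (Finset.univ : Finset Bool) := by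
      intro x hx
      simp only [Finset.mem_image, Finset.mem_product, Finset.mem_univ, and_true] at hx
      obtain ⟨⟨v, i⟩, hv, rfl⟩ := hx
      simp only [Finset.mem_product, Finset.mem_univ, and_true, Finset.mem_biUnion]
      refine ⟨v, hv, ?_⟩
      cases i <;> simp [t]
    have h2 := Finset.card_le_card h1
    rw [Finset.card_image_of_injective _ hg, Finset.card_product, Finset.card_product] at h2
    simp only [Finset.card_univ, Fintype.card_bool] at h2
    omega
  obtain ⟨f, hf, hft⟩ := (Finset.all_card_le_biUnion_card_iff_exists_injective t).1 hall
  refine ⟨f, hf, fun v => ?_⟩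
  have := hft v
  simp only [t, Finset.mem_insert, Finset.mem_singleton] at this
  rcases this with h | h
  · exact ⟨false, (g (v, false)).2, by rw [h]⟩
  · exact ⟨true, (g (v, true)).2, by rw [h]⟩

theorem isSpHom_doubleSwitch (S : SignedGraph V) (T : SignedGraph W) (f : V → W) (s : V → Bool)
    (hadj : ∀ u v, S.G.Adj u v → T.G.Adj (f u) (f v))
    (hs : ∀ u v, S.G.Adj u v → T.sign (f u) (f v) = ((s u == s v) == S.sign u v)) :
    IsSpHom (doubleSwitch S) (doubleSwitch T) (fun p => (f p.1, p.2 == s p.1)) := by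
  rintro ⟨u, i⟩ ⟨v, j⟩ h
  have h' : S.G.Adj u v := h
  refine ⟨hadj u v h', ?_⟩
  simp only [doubleSwitch]
  rw [hs u v h']
  cases s u <;> cases s v <;> cases i <;> cases j <;> cases S.sign u v <;> rfl

end SignedGraph

open SignedGraph in
/-- Two signed graphs are isomorphic iff their double switching graphs are
sp-isomorphic. -/
theorem exists_isIso_iff_exists_isSpIso_doubleSwitch {V W : Type} [Fintype V] [Fintype W]
    (S : SignedGraph V) (T : SignedGraph W) :
    (∃ f : V → W, IsIso S T f) ↔
      (∃ g : V × Bool → W × Bool, IsSpIso (doubleSwitch S) (doubleSwitch T) g) := by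
  constructor
  · rintro ⟨f, -, hf, g, hgf, hfg, hg⟩
    obtain ⟨s, hs⟩ := exists_switch_of_isHom S T f hf
    have hgs : ∀ u v, T.G.Adj u v →
        S.sign (g u) (g v) = ((s (g u) == s (g v)) == T.sign u v) := by
      intro u v h
      have := hs _ _ (hg.1 u v h)
      rw [hfg u, hfg v] at this
      rw [this]
      cases s (g u) <;> cases s (g v) <;> cases S.sign (g u) (g v) <;> rfl
    have hL : Function.LeftInverse (fun p : W × Bool => (g p.1, p.2 == s (g p.1)))
        (fun p : V × Bool => (f p.1, p.2 == s p.1)) := by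
      rintro ⟨v, i⟩
      simp only [hgf v]
      cases s v <;> cases i <;> rfl
    have hR : Function.RightInverse (fun p : W × Bool => (g p.1, p.2 == s (g p.1)))
        (fun p : V × Bool => (f p.1, p.2 == s p.1)) := by
      rintro ⟨v, i⟩
      simp only [hfg v]
      cases s (g v) <;> cases i <;> rfl
    exact ⟨_, ⟨hL.injective, hR.surjective⟩, isSpHom_doubleSwitch S T f s hf.1 hs, _, hL, hR,
      isSpHom_doubleSwitch T S g (fun w => s (g w)) hg.1 hgs⟩
  · rintro ⟨g, hbij, hg, g', hL, hR, hg'⟩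
    obtain ⟨f, hinj, hf⟩ := exists_transversal g hbij.1
    choose i j hij using hf
    have hcard : Fintype.card V = Fintype.card W := by
      have := Fintype.card_of_bijective hbij
      simp only [Fintype.card_prod, Fintype.card_bool] at this
      omega
    have hfb : Function.Bijective f := (Fintype.bijective_iff_injective_and_card f).2 ⟨hinj, hcard⟩
    have hadj : ∀ u v, S.G.Adj u v → T.G.Adj (f u) (f v) := by
      intro u v h
      have := (hg (u, i u) (v, i v) h).1
      rw [hij, hij] at this
      exact this
    have hadj' : ∀ u v, T.G.Adj (f u) (f v) → S.G.Adj u v := by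
      intro u v h
      have := (hg' (f u, j u) (f v, j v) h).1
      rw [← hij, ← hij, hL, hL] at this
      exact this
    have hs : ∀ u v, S.G.Adj u v →
        T.sign (f u) (f v) = (((i u == j u) == (i v == j v)) == S.sign u v) := by
      intro u v h
      have := (hg (u, i u) (v, i v) h).2
      rw [hij, hij] at this
      simp only [doubleSwitch] at this
      revert this
      generalize T.sign _ _ = x
      generalize S.sign _ _ = y
      generalize i u = a
      generalize i v = b
      generalize j u = c
      generalize j v = d
      revert x y a b c d
      decide
    obtain ⟨k, hkf, hfk⟩ := Function.bijective_iff_has_inverse.1 hfb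
    have hkadj : ∀ u v, T.G.Adj u v → S.G.Adj (k u) (k v) := by
      intro u v h
      apply hadj'
      rwa [hfk, hfk]
    refine ⟨f, hfb, isHom_of_switch S T f (fun v => i v == j v) hadj hs, k, hkf, hfk,
      isHom_of_switch T S k (fun w => i (k w) == j (k w)) hkadj ?_⟩
    intro u v h
    have := hs _ _ (hkadj u v h)
    rw [hfk u, hfk v] at this
    rw [this]
    generalize (i (k u) == j (k u)) = a
    generalize (i (k v) == j (k v)) = b
    cases a <;> cases b <;> cases S.sign (k u) (k v) <;> rfl
end

section
/- For every Δ ≥ 29: (i) every connected finite simple graph G with maximum degree at most Δ and every signature σ of G satisfy χ_s((G,σ)) ≤ (Δ−3)·(Δ−1)·2^{Δ−1} + 2; and (ii) there exist a connected finite simple graph G with maximum degree at most Δ and a signature σ of G such that χ_s((G,σ)) ≥ 2^{Δ/2 − 1} (as real numbers; equivalently, χ_s((G,σ))² ≥ 2^{Δ−2}). -/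
open SimpleGraph

/-! ### Counting signings -/

theorem aux_card_avoid {E Y : Type} [Fintype E] [Fintype Y] (k : ℕ) (hk : 1 ≤ k)
    (ι : Y × Fin k → E) (hι : Function.Injective ι) (α : Fin k → Bool) :
    (Nat.card {s : E → Bool // ∀ y, ∀ ε, ∃ i, s (ι (y, i)) ≠ (α i ^^ ε)} : ℝ) ≤
      (1 - 2 / 2 ^ k) ^ (Fintype.card Y) * 2 ^ (Fintype.card E) := by
  classical
  let B := {β : Fin k → Bool // β ≠ α ∧ β ≠ fun i => !(α i)}
  let R := {e : E // e ∉ Set.range ι}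
  let Φ : {s : E → Bool // ∀ y, ∀ ε, ∃ i, s (ι (y, i)) ≠ (α i ^^ ε)} → (Y → B) × (R → Bool) :=
    fun s => (fun y => ⟨fun i => s.1 (ι (y, i)), by
        constructor
        · intro h
          obtain ⟨i, hi⟩ := s.2 y false
          exact hi (by simpa using congrFun h i)
        · intro h
          obtain ⟨i, hi⟩ := s.2 y true
          exact hi (by simpa using congrFun h i)⟩, fun e => s.1 e.1)
  have hΦ : Function.Injective Φ := by
    intro s t h
    apply Subtype.ext
    funext e
    by_cases he : e ∈ Set.range ι
    · obtain ⟨⟨y, i⟩, rfl⟩ := he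
      have h1 := congrFun (congrArg Prod.fst h) y
      exact congrFun (congrArg Subtype.val h1) i
    · exact congrFun (congrArg Prod.snd h) ⟨e, he⟩
  have hB : Fintype.card B = 2 ^ k - 2 := by
    have h1 : Fintype.card B =
        ((Finset.univ : Finset (Fin k → Bool)) \ {α, fun i => !(α i)}).card := by
      rw [Fintype.card_subtype]
      congr 1
      ext β
      simp
    have hne : α ≠ fun i => !(α i) := by
      intro h
      have := congrFun h ⟨0, hk⟩
      simp at this
    rw [h1, Finset.card_sdiff_of_subset (Finset.subset_univ _), Finset.card_pair hne]
    simp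
  have hR : Fintype.card R + Fintype.card Y * k = Fintype.card E := by
    have h1 : Fintype.card R = Fintype.card E - Fintype.card (Set.range ι) :=
      Fintype.card_subtype_compl (fun e => e ∈ Set.range ι)
    have h2 : Fintype.card (Set.range ι) = Fintype.card Y * k := by
      rw [Set.card_range_of_injective hι]; simp
    have h3 : Fintype.card (Y × Fin k) ≤ Fintype.card E := Fintype.card_le_of_injective ι hι
    simp at h3
    omega
  have hc := Nat.card_le_card_of_injective Φ hΦ
  have h2 : Nat.card ((Y → B) × (R → Bool)) =
      (2 ^ k - 2) ^ Fintype.card Y * 2 ^ Fintype.card R := by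
    rw [Nat.card_eq_fintype_card]
    simp [hB]
  rw [h2] at hc
  have h3 : (1 - 2 / 2 ^ k : ℝ) ^ (Fintype.card Y) * 2 ^ (Fintype.card E) =
      ((2 ^ k - 2 : ℕ) : ℝ) ^ Fintype.card Y * 2 ^ Fintype.card R := by
    rw [← hR, pow_add, Nat.cast_sub (by
      calc 2 = 2 ^ 1 := rfl
        _ ≤ 2 ^ k := Nat.pow_le_pow_right (by norm_num) hk)]
    have : (1 - 2 / 2 ^ k : ℝ) = ((2 : ℝ) ^ k - 2) / 2 ^ k := by
      field_simp
    rw [this, div_pow, mul_comm (Fintype.card Y) k, pow_mul 2 k]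
    push_cast
    field_simp
  rw [h3]
  exact_mod_cast hc

theorem aux_numeric (k : ℕ) (hk : 28 ≤ k) (m : ℕ) (hm : (k - 2) * k * 2 ^ k ≤ m + (2 * k - 1)) :
    ((((k - 2) * k * 2 ^ k : ℕ) : ℝ) ^ k * 2 ^ k * (((k - 2) * k * 2 ^ k : ℕ) : ℝ) ^ (k - 1)) *
      (1 - 2 / 2 ^ k) ^ m < 1 := by
  have hkr : (28 : ℝ) ≤ k := by exact_mod_cast hk
  have hP : (2 : ℝ) ^ 28 ≤ 2 ^ k := pow_le_pow_right₀ (by norm_num) hk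
  have hk2 : 20 * (k : ℝ) ≤ 2 ^ k := by
    have : 20 * k ≤ 2 ^ k := by
      obtain ⟨t, rfl⟩ := Nat.exists_eq_add_of_le hk
      clear hk hkr hP hm
      induction t with
      | zero => norm_num
      | succ n ih => rw [← add_assoc, pow_succ]; omega
    exact_mod_cast this
  have hN : (((k - 2) * k * 2 ^ k : ℕ) : ℝ) = (k - 2) * k * 2 ^ k := by
    rw [Nat.cast_mul, Nat.cast_mul, Nat.cast_sub (by omega)]; push_cast; ring
  have hm' : ((k : ℝ) - 2) * k * 2 ^ k ≤ m + (2 * k - 1) := by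
    have : (((k - 2) * k * 2 ^ k : ℕ) : ℝ) ≤ ((m + (2 * k - 1) : ℕ) : ℝ) := by exact_mod_cast hm
    rw [hN, Nat.cast_add, Nat.cast_sub (n := 2 * k) (m := 1) (by omega)] at this
    push_cast at this
    exact this
  rw [hN]
  have hlogP : Real.log ((2 : ℝ) ^ k) = k * Real.log 2 := by rw [Real.log_pow]
  set P : ℝ := 2 ^ k with hPdef
  have hPpos : 0 < P := by positivity
  have hx0 : 0 < ((k : ℝ) - 2) * k := by nlinarith
  set L := Real.log (((k : ℝ) - 2) * k * P) with hL
  have hexp : ((k : ℝ) - 2) * k * P = Real.exp L := (Real.exp_log (by positivity)).symm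
  have hLe : L = Real.log (((k : ℝ) - 2) * k) + k * Real.log 2 := by
    rw [hL, Real.log_mul hx0.ne' hPpos.ne', hlogP]
  have hPe : P = Real.exp (k * Real.log 2) := by rw [← hlogP, Real.exp_log hPpos]
  have hlog3 : 5 * Real.log 3 ≤ 8 * Real.log 2 := by
    have h1 : Real.log ((3 : ℝ) ^ 5) ≤ Real.log ((2 : ℝ) ^ 8) :=
      Real.log_le_log (by norm_num) (by norm_num)
    rw [Real.log_pow, Real.log_pow] at h1
    exact_mod_cast h1
  have hlogx : Real.log (((k : ℝ) - 2) * k) ≤ 2 * (3 * Real.log 3 + (k - 28) / 27) := by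
    have h1 : Real.log (((k : ℝ) - 2) * k) ≤ Real.log (((k : ℝ) - 1) ^ 2) :=
      Real.log_le_log hx0 (by nlinarith)
    have h2 : Real.log ((k : ℝ) - 1) = Real.log ((3 : ℝ) ^ 3) + Real.log ((k - 1) / 27) := by
      rw [← Real.log_mul (by norm_num) (by
        have : (0 : ℝ) < k - 1 := by linarith
        positivity)]
      congr 1
      ring
    have h3 : Real.log (((k : ℝ) - 1) / 27) ≤ (k - 1) / 27 - 1 :=
      Real.log_le_sub_one_of_pos (by
        have : (0 : ℝ) < k - 1 := by linarith
        positivity)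
    rw [Real.log_pow, h2, Real.log_pow] at h1
    push_cast at h1
    linarith
  have hpw : (1 - 2 / P) ^ m ≤ Real.exp (-(2 / P) * m) := by
    rw [mul_comm, Real.exp_nat_mul]
    apply pow_le_pow_left₀
    · rw [sub_nonneg, div_le_one hPpos]; linarith
    · have := Real.add_one_le_exp (-(2 / P)); linarith
  have hmP : 2 * (((k : ℝ) - 2) * k) - 1 / 5 ≤ (2 / P) * m := by
    rw [div_mul_eq_mul_div, le_div_iff₀ hPpos]
    nlinarith
  have hfin : (k : ℝ) * L + k * Real.log 2 + (k - 1) * L - (2 / P) * m < 0 := by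
    have hl2 := Real.log_two_lt_d9
    have hA : L ≤ 2 * (3 * (8 / 5 * 0.6931471808) + (k - 28) / 27) + k * 0.6931471808 := by
      rw [hLe]
      have : (k : ℝ) * Real.log 2 ≤ k * 0.6931471808 := by gcongr
      linarith
    have hB : (2 * (k : ℝ) - 1) * L ≤ (2 * (k : ℝ) - 1) *
        (2 * (3 * (8 / 5 * 0.6931471808) + (k - 28) / 27) + k * 0.6931471808) := by
      apply mul_le_mul_of_nonneg_left hA
      linarith
    have hC : (k : ℝ) * Real.log 2 ≤ k * 0.6931471808 := by gcongr
    nlinarith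
  calc ((((k : ℝ) - 2) * k * P) ^ k * P * (((k : ℝ) - 2) * k * P) ^ (k - 1)) * (1 - 2 / P) ^ m
      ≤ (Real.exp L ^ k * Real.exp (k * Real.log 2) * Real.exp L ^ (k - 1)) *
        Real.exp (-(2 / P) * m) := by
        rw [hexp, ← hPe]
        gcongr
    _ = Real.exp ((k : ℝ) * L + k * Real.log 2 + (k - 1) * L - (2 / P) * m) := by
        rw [← Real.exp_nat_mul, ← Real.exp_nat_mul, ← Real.exp_add, ← Real.exp_add,
          ← Real.exp_add, Nat.cast_sub (by omega)]
        congr 1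
        push_cast
        ring
    _ < 1 := by rw [Real.exp_lt_one_iff]; exact hfin

/-- A signing of the complete graph on `N` vertices with a strong extension property. -/
theorem aux_exists_signing (k : ℕ) (hk : 28 ≤ k) (N : ℕ) (hN : N = (k - 2) * k * 2 ^ k) :
    ∃ τ : Sym2 (Fin N) → Bool, ∀ (A : Fin k → Fin N), Function.Injective A →
      ∀ (α : Fin k → Bool) (F : Fin (k - 1) → Fin N),
        ∃ y, y ∉ Set.range A ∧ y ∉ Set.range F ∧ ∃ ε, ∀ i, τ s(y, A i) = (α i ^^ ε) := by
  classical
  by_contra hcon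
  push Not at hcon
  let E := Sym2 (Fin N)
  let D := (Fin k → Fin N) × (Fin k → Bool) × (Fin (k - 1) → Fin N)
  let bad : D → Finset (E → Bool) := fun d => Finset.univ.filter fun τ =>
    Function.Injective d.1 ∧ ∀ y, y ∉ Set.range d.1 → y ∉ Set.range d.2.2 →
      ∀ ε, ∃ i, τ s(y, d.1 i) ≠ (d.2.1 i ^^ ε)
  have hcov : (Finset.univ : Finset (E → Bool)) ⊆ Finset.univ.biUnion bad := by
    intro τ _
    obtain ⟨A, hA, α, F, h⟩ := hcon τ
    rw [Finset.mem_biUnion]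
    exact ⟨(A, α, F), Finset.mem_univ _, Finset.mem_filter.2 ⟨Finset.mem_univ _, hA, h⟩⟩
  let M := N - (2 * k - 1)
  let q : ℝ := (1 - 2 / 2 ^ k) ^ M * 2 ^ Fintype.card E
  have hq0 : (0 : ℝ) ≤ 1 - 2 / 2 ^ k := by
    rw [sub_nonneg, div_le_one (by positivity)]
    calc (2 : ℝ) = 2 ^ 1 := by norm_num
      _ ≤ 2 ^ k := pow_le_pow_right₀ (by norm_num) (by omega)
  have hbad : ∀ d, ((bad d).card : ℝ) ≤ q := by
    rintro ⟨A, α, F⟩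
    by_cases hA : Function.Injective A
    · let Y := {y : Fin N // y ∉ Set.range A ∧ y ∉ Set.range F}
      let ι : Y × Fin k → E := fun p => s(p.1.1, A p.2)
      have hι : Function.Injective ι := by
        rintro ⟨y, i⟩ ⟨y', i'⟩ h
        rcases Sym2.eq_iff.1 h with ⟨h1, h2⟩ | ⟨h1, h2⟩
        · exact Prod.ext (Subtype.ext h1) (hA h2)
        · exact absurd ⟨i', h1.symm⟩ y.2.1
      have hYM : M ≤ Fintype.card Y := by
        have h1 : Fintype.card Y = (Finset.univ \ (Finset.univ.image A ∪ Finset.univ.image F)).card := by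
          rw [Fintype.card_subtype]
          congr 1
          ext y
          simp
        have h2 := Finset.le_card_sdiff (Finset.univ.image A ∪ Finset.univ.image F)
          (Finset.univ : Finset (Fin N))
        have h3 := Finset.card_union_le (Finset.univ.image A) (Finset.univ.image F)
        have h4 : (Finset.univ.image A).card ≤ k := by simpa using Finset.card_image_le (s := Finset.univ) (f := A)
        have h5 : (Finset.univ.image F).card ≤ k - 1 := by simpa using Finset.card_image_le (s := Finset.univ) (f := F)
        have h6 : (Finset.univ : Finset (Fin N)).card = N := by simp
        omega
      have h1 := aux_card_avoid k (by omega) ι hι α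
      have h2 : (bad (A, α, F)).card =
          Nat.card {s : E → Bool // ∀ y, ∀ ε, ∃ i, s (ι (y, i)) ≠ (α i ^^ ε)} := by
        rw [Nat.card_eq_fintype_card, Fintype.card_subtype]
        congr 1
        ext τ
        simp only [bad, Finset.mem_filter, Finset.mem_univ, true_and]
        constructor
        · rintro ⟨_, h⟩ y ε
          exact h y.1 y.2.1 y.2.2 ε
        · intro h
          exact ⟨hA, fun y h1 h2 ε => h ⟨y, h1, h2⟩ ε⟩
      rw [h2]
      refine h1.trans ?_
      have h3 : (1 - 2 / 2 ^ k : ℝ) ^ Fintype.card Y ≤ (1 - 2 / 2 ^ k) ^ M :=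
        pow_le_pow_of_le_one hq0 (by
          have : (0 : ℝ) ≤ 2 / 2 ^ k := by positivity
          linarith) hYM
      exact mul_le_mul_of_nonneg_right h3 (by positivity)
    · have : bad (A, α, F) = ∅ := by
        apply Finset.filter_eq_empty_iff.2
        rintro τ _ ⟨h, _⟩
        exact hA h
      rw [this]
      simp only [Finset.card_empty, Nat.cast_zero]
      positivity
  have h1 : ((Finset.univ : Finset (E → Bool)).card : ℝ) ≤ (Fintype.card D : ℝ) * q := by
    calc ((Finset.univ : Finset (E → Bool)).card : ℝ) ≤ ((Finset.univ.biUnion bad).card : ℝ) := by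
          exact_mod_cast Finset.card_le_card hcov
      _ ≤ ∑ d : D, ((bad d).card : ℝ) := by exact_mod_cast Finset.card_biUnion_le
      _ ≤ ∑ d : D, q := Finset.sum_le_sum fun d _ => hbad d
      _ = (Fintype.card D : ℝ) * q := by simp [Finset.sum_const, Finset.card_univ]
  have h2 : ((Finset.univ : Finset (E → Bool)).card : ℝ) = 2 ^ Fintype.card E := by
    rw [Finset.card_univ, Fintype.card_fun]; simp
  have h3 : (Fintype.card D : ℝ) = (N : ℝ) ^ k * 2 ^ k * (N : ℝ) ^ (k - 1) := by
    simp [D, mul_assoc]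
  have h4 := aux_numeric k hk M (by omega)
  rw [← hN, ← h3] at h4
  rw [h2] at h1
  have h5 : (0 : ℝ) < 2 ^ Fintype.card E := by positivity
  have h6 : (Fintype.card D : ℝ) * q < 1 * 2 ^ Fintype.card E := by
    simp only [q]
    rw [← mul_assoc]
    exact mul_lt_mul_of_pos_right h4 h5
  linarith

/-- Extension property for at most `k` vertices. -/
theorem aux_extend (k : ℕ) (N : ℕ) (hkN : k < N) (τ : Sym2 (Fin N) → Bool)
    (hτ : ∀ (A : Fin k → Fin N), Function.Injective A →
      ∀ (α : Fin k → Bool) (F : Fin (k - 1) → Fin N),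
        ∃ y, y ∉ Set.range A ∧ y ∉ Set.range F ∧ ∃ ε, ∀ i, τ s(y, A i) = (α i ^^ ε))
    (d : ℕ) : ∀ (A : Finset (Fin N)) (α : Fin N → Bool) (F : Finset (Fin N)), A.Nonempty →
      A.card + d = k → F.card < 2 ^ d * k →
      ∃ y, y ∉ A ∧ y ∉ F ∧ ∃ ε, ∀ a ∈ A, τ s(y, a) = (α a ^^ ε) := by
  classical
  induction d with
  | zero =>
    intro A α F hA hc hF
    have hc' : A.card = k := by omega
    let e := A.equivFinOfCardEq hc'
    obtain ⟨z, hz⟩ := hA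
    let g : Fin (k - 1) → Fin N := fun i => F.toList.getD i z
    obtain ⟨y, hy1, hy2, ε, h⟩ := hτ (fun i => (e.symm i).1)
      (fun i j h => e.symm.injective (Subtype.ext h)) (fun i => α (e.symm i).1) g
    refine ⟨y, fun hyA => hy1 ⟨e ⟨y, hyA⟩, by simp⟩, fun hyF => hy2 ?_, ε, fun a ha => ?_⟩
    · obtain ⟨n, hn, hn2⟩ := List.getElem_of_mem (Finset.mem_toList.2 hyF)
      have hl : n < F.card := by simpa using hn
      refine ⟨⟨n, by omega⟩, ?_⟩
      simp only [g]
      rw [List.getD_eq_getElem _ _ hn, hn2]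
    · have := h (e ⟨a, ha⟩)
      simpa using this
  | succ d ih =>
    intro A α F hA hc hF
    obtain ⟨z, hz⟩ : ∃ z, z ∉ A := by
      by_contra hcon
      push Not at hcon
      have : A = Finset.univ := Finset.eq_univ_iff_forall.2 hcon
      rw [this] at hc
      simp at hc
      omega
    obtain ⟨a0, ha0⟩ := hA
    let t : Fin N → Bool := fun y => (τ s(y, z) ^^ (τ s(y, a0) ^^ α a0))
    obtain ⟨b, hb⟩ : ∃ b : Bool, (F.filter fun y => t y = b).card < 2 ^ d * k := by
      by_contra hcon
      push Not at hcon
      have h1 := hcon true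
      have h2 := hcon false
      have h3 := Finset.card_filter_add_card_filter_not (s := F) (fun y => t y = true)
      simp only [Bool.not_eq_true] at h3
      rw [pow_succ] at hF
      have : 2 ^ d * 2 * k = 2 ^ d * k + 2 ^ d * k := by ring
      omega
    obtain ⟨y, hy1, hy2, ε, h⟩ := ih (insert z A) (Function.update α z b) (F.filter fun y => t y = b)
      ⟨z, Finset.mem_insert_self _ _⟩ (by rw [Finset.card_insert_of_notMem hz]; omega) hb
    have hne : ∀ a ∈ A, a ≠ z := fun a ha h => hz (h ▸ ha)
    have h' : ∀ a ∈ A, τ s(y, a) = (α a ^^ ε) := by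
      intro a ha
      have := h a (Finset.mem_insert_of_mem ha)
      rwa [Function.update_of_ne (hne a ha)] at this
    refine ⟨y, fun hA => hy1 (Finset.mem_insert_of_mem hA), fun hF' => hy2 ?_, ε, h'⟩
    rw [Finset.mem_filter]
    refine ⟨hF', ?_⟩
    have hz1 := h z (Finset.mem_insert_self _ _)
    rw [Function.update_self] at hz1
    have ha1 := h' a0 ha0
    simp only [t, hz1, ha1]
    cases b <;> cases ε <;> cases α a0 <;> rfl

theorem aux_extend' (k : ℕ) (hk : 28 ≤ k) (N : ℕ) (hkN : k < N) (τ : Sym2 (Fin N) → Bool)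
    (hτ : ∀ (A : Fin k → Fin N), Function.Injective A →
      ∀ (α : Fin k → Bool) (F : Fin (k - 1) → Fin N),
        ∃ y, y ∉ Set.range A ∧ y ∉ Set.range F ∧ ∃ ε, ∀ i, τ s(y, A i) = (α i ^^ ε))
    (A : Finset (Fin N)) (α : Fin N → Bool) (F : Finset (Fin N)) (hA : A.card ≤ k)
    (hF : F.card ≤ (k + 1 - A.card) * (k - 1)) :
      ∃ y, y ∉ A ∧ y ∉ F ∧ ∃ ε, ∀ a ∈ A, τ s(y, a) = (α a ^^ ε) := by
  rcases A.eq_empty_or_nonempty with rfl | hne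
  · obtain ⟨y, -, hy, -⟩ := aux_extend k N hkN τ hτ (k - 1) {⟨0, by omega⟩} α F
      (Finset.singleton_nonempty _) (by simp; omega) (by
        refine lt_of_le_of_lt hF ?_
        have h : ∀ n, n + 3 + 2 ≤ 2 ^ (n + 3) := by
          intro n
          induction n with
          | zero => norm_num
          | succ n ih => rw [show n + 1 + 3 = n + 3 + 1 by ring, pow_succ]; omega
        have h1 := h (k - 1 - 3)
        rw [show k - 1 - 3 + 3 = k - 1 by omega] at h1
        simp only [Finset.card_empty, Nat.sub_zero]
        calc (k + 1) * (k - 1) < (k + 1) * k := Nat.mul_lt_mul_of_pos_left (by omega) (by omega)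
          _ ≤ 2 ^ (k - 1) * k := Nat.mul_le_mul_right _ (by omega))
    exact ⟨y, by simp, hy, true, by simp⟩
  · refine aux_extend k N hkN τ hτ (k - A.card) A α F hne (by omega) (lt_of_le_of_lt hF ?_)
    have h1 : k - A.card < 2 ^ (k - A.card) := Nat.lt_two_pow_self
    calc (k + 1 - A.card) * (k - 1) < (k + 1 - A.card) * k :=
          Nat.mul_lt_mul_of_pos_left (by omega) (by omega)
      _ ≤ 2 ^ (k - A.card) * k := Nat.mul_le_mul_right _ (by omega)

/-! ### Switching and homomorphisms -/

namespace SignedGraph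

theorem aux_walkSign_cons {V : Type} (S : SignedGraph V) {u v w : V} (h : S.G.Adj u v)
    (p : S.G.Walk v w) : S.walkSign (Walk.cons h p) = (S.sign u v == S.walkSign p) := by
  simp [walkSign]

theorem aux_walkSign_nil {V : Type} (S : SignedGraph V) (u : V) :
    S.walkSign (Walk.nil : S.G.Walk u u) = true := by
  simp [walkSign]

theorem aux_walkSign_append {V : Type} (S : SignedGraph V) {u v w : V} (p : S.G.Walk u v)
    (q : S.G.Walk v w) : S.walkSign (p.append q) = (S.walkSign p == S.walkSign q) := by
  induction p with
  | nil => simp [aux_walkSign_nil]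
  | cons h p ih =>
    rw [Walk.cons_append, aux_walkSign_cons, aux_walkSign_cons, ih]
    cases S.sign _ _ <;> cases S.walkSign p <;> cases S.walkSign q <;> rfl

theorem aux_walkSign_reverse {V : Type} (S : SignedGraph V) {u v : V} (p : S.G.Walk u v) :
    S.walkSign p.reverse = S.walkSign p := by
  induction p with
  | nil => simp
  | @cons a b c h p ih =>
    rw [Walk.reverse_cons, aux_walkSign_append, ih, aux_walkSign_cons, aux_walkSign_cons,
      aux_walkSign_nil, S.sign_symm b a]
    cases S.sign a b <;> cases S.walkSign p <;> rfl

theorem aux_isHom {V W : Type} (S : SignedGraph V) (T : SignedGraph W) (f : V → W) (s : V → Bool)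
    (h : ∀ u v, S.G.Adj u v → T.G.Adj (f u) (f v) ∧
      T.sign (f u) (f v) = ((s u == s v) == S.sign u v)) : IsHom S T f := by
  refine ⟨fun u v huv => (h u v huv).1, ?_⟩
  have key : ∀ (u v : V) (w : S.G.Walk u v),
      T.walkSign (w.map (⟨f, fun {a b} hab => (h a b hab).1⟩ : S.G →g T.G)) =
        ((s u == s v) == S.walkSign w) := by
    intro u v w
    induction w with
    | nil => simp [aux_walkSign_nil]
    | @cons a b c hab p ih =>
      rw [Walk.map_cons, aux_walkSign_cons, ih, aux_walkSign_cons]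
      have := (h a b hab).2
      change (T.sign (f a) (f b) == _) = _
      rw [this]
      cases s a <;> cases s b <;> cases s c <;> cases S.sign a b <;> cases S.walkSign p <;> rfl
  intro u w
  rw [key]
  simp

theorem aux_switch_of_isHom {V W : Type} (S : SignedGraph V) (T : SignedGraph W) (f : V → W)
    (hc : S.G.Connected) (h : IsHom S T f) :
    ∃ s : V → Bool, ∀ u v, S.G.Adj u v →
      S.sign u v = ((s u == s v) == T.sign (f u) (f v)) := by
  obtain ⟨hadj, hw⟩ := h
  obtain ⟨r⟩ := hc.nonempty
  have p : ∀ v, S.G.Walk r v := fun v => (hc.preconnected r v).some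
  let φ : S.G →g T.G := ⟨f, fun {a b} h => hadj a b h⟩
  refine ⟨fun v => (T.walkSign ((p v).map φ) == S.walkSign (p v)), fun u v huv => ?_⟩
  have h1 := hw r ((p u).append (Walk.cons huv (p v).reverse))
  change T.walkSign (Walk.map φ _) = _ at h1
  rw [Walk.map_append, Walk.map_cons, ← Walk.reverse_map, aux_walkSign_append, aux_walkSign_append,
    aux_walkSign_cons, aux_walkSign_cons, aux_walkSign_reverse, aux_walkSign_reverse] at h1
  change (_ == (T.sign (f u) (f v) == _)) = _ at h1
  simp only
  revert h1
  generalize T.walkSign ((p u).map φ) = x1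
  generalize T.walkSign ((p v).map φ) = x2
  generalize S.walkSign (p u) = x3
  generalize S.walkSign (p v) = x4
  generalize T.sign (f u) (f v) = x5
  generalize S.sign u v = x6
  revert x1 x2 x3 x4 x5 x6
  decide

theorem aux_chromS_le {V W : Type} [Fintype W] (S : SignedGraph V) (n : ℕ)
    (hn : Fintype.card W = n) (τ : W → W → Bool) (hτ : ∀ a b, τ a b = τ b a)
    (f : V → W) (s : V → Bool)
    (h : ∀ u v, S.G.Adj u v → f u ≠ f v ∧ τ (f u) (f v) = ((s u == s v) == S.sign u v)) :
    chromS S ≤ n := by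
  let e := Fintype.equivFinOfCardEq hn
  let T : SignedGraph (Fin n) := ⟨⊤, fun a b => τ (e.symm a) (e.symm b), fun a b => hτ _ _⟩
  apply Nat.sInf_le
  refine ⟨T, fun v => e (f v), aux_isHom S T _ s fun u v huv => ⟨?_, ?_⟩⟩
  · simpa [T] using (h u v huv).1
  · simpa [T] using (h u v huv).2

/-! ### Lower bound -/

theorem aux_lower_count (m M : ℕ) (G : SimpleGraph (Fin m)) (hc : G.Connected)
    (hcount : M ^ m * 2 ^ (M * M) * 2 ^ m < 2 ^ Nat.card G.edgeSet) :
    ∃ S : SignedGraph (Fin m), S.G = G ∧ M < chromS S := by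
  classical
  by_contra hcon
  push Not at hcon
  let D := (Fin m → Fin M) × (Fin M × Fin M → Bool) × (Fin m → Bool)
  let mk : (G.edgeSet → Bool) → SignedGraph (Fin m) := fun g =>
    ⟨G, fun u v => if h : s(u, v) ∈ G.edgeSet then g ⟨s(u, v), h⟩ else true, fun u v => by
      simp only [Sym2.eq_swap (a := u) (b := v)]⟩
  have hex : ∀ g : G.edgeSet → Bool, ∃ d : D, ∀ u v, ∀ h : G.Adj u v,
      g ⟨s(u, v), h⟩ = ((d.2.2 u == d.2.2 v) == d.2.1 (d.1 u, d.1 v)) := by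
    intro g
    have hle := hcon (mk g) rfl
    have hmem : chromS (mk g) ∈ {n : ℕ | ∃ T : SignedGraph (Fin n), ∃ f : Fin m → Fin n,
        IsHom (mk g) T f} := by
      apply Nat.sInf_mem
      exact ⟨m, mk g, id, aux_isHom _ _ _ (fun _ => true) fun u v huv => ⟨huv, by simp⟩⟩
    obtain ⟨T, f, hf⟩ := hmem
    obtain ⟨s, hs⟩ := aux_switch_of_isHom (mk g) T f hc hf
    let inv : Fin M → Fin (chromS (mk g)) := fun a =>
      if h : a.1 < chromS (mk g) then ⟨a.1, h⟩ else f hc.nonempty.some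
    refine ⟨(fun v => Fin.castLE hle (f v), fun p => T.sign (inv p.1) (inv p.2), s),
      fun u v huv => ?_⟩
    have h1 := hs u v huv
    have h2 : (mk g).sign u v = g ⟨s(u, v), huv⟩ := by
      have h0 : s(u, v) ∈ G.edgeSet := huv
      simp only [mk]
      rw [dif_pos h0]
    have h3 : ∀ v, inv (Fin.castLE hle (f v)) = f v := by
      intro v
      simp [inv]
    simp only [h3]
    rw [← h2]
    exact h1
  choose φ hφ using hex
  have hinj : Function.Injective φ := by
    intro g g' h
    funext ⟨e, he⟩
    induction e using Sym2.ind with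
    | _ u v =>
      rw [hφ g u v he, hφ g' u v he, h]
  have := Nat.card_le_card_of_injective φ hinj
  have h1 : Nat.card D = M ^ m * 2 ^ (M * M) * 2 ^ m := by
    simp [D, mul_assoc]
  rw [h1] at this
  simp only [Nat.card_fun, Nat.card_eq_fintype_card (α := Bool), Fintype.card_bool] at this
  omega

theorem aux_lower (Δ : ℕ) (hΔ : 29 ≤ Δ) :
    ∃ (m : ℕ) (S : SignedGraph (Fin m)), S.G.Connected ∧
        (∀ v, (S.G.neighborSet v).ncard ≤ Δ) ∧
        2 ^ (Δ - 2) ≤ (chromS S) ^ 2 := by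
  classical
  -- the threshold
  let M := Nat.sqrt (2 ^ (Δ - 2) - 1)
  have hpos : 0 < 2 ^ (Δ - 2) := by positivity
  have hM1 : M * M < 2 ^ (Δ - 2) := by
    have : M * M ≤ 2 ^ (Δ - 2) - 1 := Nat.sqrt_le (2 ^ (Δ - 2) - 1)
    omega
  have hM2 : 2 ^ (Δ - 2) ≤ (M + 1) * (M + 1) := by
    have : 2 ^ (Δ - 2) - 1 < (M + 1) * (M + 1) := Nat.lt_succ_sqrt (2 ^ (Δ - 2) - 1)
    omega
  have hΔ2 : 2 ^ Δ = 4 * 2 ^ (Δ - 2) := by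
    conv_lhs => rw [show Δ = (Δ - 2) + 2 by omega, pow_add]
    ring
  -- large size
  obtain ⟨n, hn⟩ : ∃ n, ∀ m, n ≤ m → (4 * (M * M)) ^ m * 2 ^ (2 * (M * M)) < (2 ^ Δ) ^ m := by
    have hlt : 4 * (M * M) < 2 ^ Δ := by omega
    have hMpos : 0 < 4 * (M * M) := by
      have : 0 < M := by
        by_contra h
        have h0 : M = 0 := by omega
        rw [h0] at hM2
        have : 2 ^ 1 ≤ 2 ^ (Δ - 2) := Nat.pow_le_pow_right (by norm_num) (by omega)
        omega
      positivity
    generalize 4 * (M * M) = a at *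
    generalize 2 ^ Δ = b at *
    have har : (0 : ℝ) < a := by exact_mod_cast hMpos
    have h1 : (1 : ℝ) < b / a := by
      rw [one_lt_div har]; exact_mod_cast hlt
    obtain ⟨n, hn⟩ := pow_unbounded_of_one_lt (2 ^ (2 * (M * M)) : ℝ) h1
    refine ⟨n, fun m hm => ?_⟩
    have h2 : (2 ^ (2 * (M * M)) : ℝ) < (b / a) ^ m :=
      hn.trans_le (pow_le_pow_right₀ h1.le hm)
    rw [div_pow, lt_div_iff₀ (by positivity)] at h2
    rw [mul_comm]
    exact_mod_cast h2
  -- the graph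
  let H : SimpleGraph (Fin (n + 3) × Fin (Δ - 1)) := cycleGraph (n + 3) □ (⊤ : SimpleGraph (Fin (Δ - 1)))
  have : Nonempty (Fin (Δ - 1)) := ⟨⟨0, by omega⟩⟩
  have hHc : H.Connected :=
    (cycleGraph_connected (n := n + 2)).boxProd connected_top
  have hHd : ∀ v, H.degree v = Δ := by
    intro v
    have : H.degree v = (cycleGraph (n + 3)).degree v.1 + (⊤ : SimpleGraph (Fin (Δ - 1))).degree v.2 := by
      convert degree_boxProd v
    rw [this, cycleGraph_degree_three_le, complete_graph_degree]
    simp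
    omega
  let m := (n + 3) * (Δ - 1)
  have hcard : Fintype.card (Fin (n + 3) × Fin (Δ - 1)) = m := by simp [m]
  let e := Fintype.equivFinOfCardEq hcard
  let G : SimpleGraph (Fin m) := H.map e.toEmbedding
  let iso : H ≃g G := Iso.map e H
  have hGc : G.Connected := iso.connected_iff.1 hHc
  have hGd : ∀ v, G.degree v = Δ := by
    intro v
    have h1 := iso.degree_eq (iso.symm v)
    rw [hHd, RelIso.apply_symm_apply] at h1
    exact h1
  have hE : 2 * Nat.card G.edgeSet = m * Δ := by
    have h1 := G.sum_degrees_eq_twice_card_edges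
    simp only [hGd] at h1
    rw [Nat.card_eq_fintype_card, ← edgeFinset_card, ← h1]
    simp
  have hcount : M ^ m * 2 ^ (M * M) * 2 ^ m < 2 ^ Nat.card G.edgeSet := by
    apply lt_of_pow_lt_pow_left₀ 2 (by positivity)
    rw [← pow_mul, mul_comm (Nat.card _), hE, mul_comm m, pow_mul 2 Δ m]
    refine lt_of_eq_of_lt ?_ (hn m ?_)
    · have h4 : (4 : ℕ) ^ m = (2 ^ m) ^ 2 := by
        rw [← pow_mul, mul_comm m 2, pow_mul 2 2 m, show (2 : ℕ) ^ 2 = 4 by norm_num]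
      have h5 : 2 ^ (2 * (M * M)) = (2 ^ (M * M)) ^ 2 := by
        rw [← pow_mul, mul_comm]
      rw [mul_pow 4, h4, h5, mul_pow M M]
      ring
    · show n ≤ (n + 3) * (Δ - 1)
      nlinarith [Nat.le_mul_of_pos_right (n + 3) (show 0 < Δ - 1 by omega)]
  obtain ⟨S, hS, hlt⟩ := aux_lower_count m M G hGc hcount
  refine ⟨m, S, by rw [hS]; exact hGc, fun v => ?_, ?_⟩
  · rw [hS, ← Nat.card_coe_set_eq, Nat.card_eq_fintype_card, card_neighborSet_eq_degree, hGd v]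
  · refine hM2.trans ?_
    rw [sq]
    exact Nat.mul_le_mul hlt hlt

end SignedGraph

/-! ### Upper bound -/

namespace SignedGraph

open Classical in
/-- The greedy colouring of all vertices but two adjacent ones. -/
theorem aux_greedy {V : Type} [Fintype V] (S : SignedGraph V) (hc : S.G.Connected)
    (k : ℕ) (hk : 28 ≤ k) (hdeg : ∀ v : V, (S.G.neighborFinset v).card ≤ k + 1)
    (N : ℕ) (hkN : k < N) (τ : Sym2 (Fin N) → Bool)
    (hτ : ∀ (A : Fin k → Fin N), Function.Injective A →
      ∀ (α : Fin k → Bool) (F : Fin (k - 1) → Fin N),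
        ∃ y, y ∉ Set.range A ∧ y ∉ Set.range F ∧ ∃ ε, ∀ i, τ s(y, A i) = (α i ^^ ε))
    (u v : V) (huv : S.G.Adj u v) (n : ℕ) :
    n + 2 ≤ Fintype.card V →
    ∃ (C : Finset V) (f : V → Fin N) (s : V → Bool), C.card = n ∧ u ∉ C ∧ v ∉ C ∧
      (∀ x ∈ C, ∀ y, y ≠ u → y ≠ v → S.G.dist u x < S.G.dist u y → y ∈ C) ∧
      (∀ x ∈ C, ∀ y ∈ C, S.G.Adj x y →
        f x ≠ f y ∧ τ s(f x, f y) = ((s x == s y) == S.sign x y)) ∧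
      (∀ w, w ∉ C → ∀ x ∈ C, ∀ y ∈ C, S.G.Adj w x → S.G.Adj w y → f x = f y → x = y) := by
  induction n with
  | zero =>
    intro _
    exact ⟨∅, fun _ => ⟨0, by omega⟩, fun _ => true, by simp⟩
  | succ n ih =>
    intro hn
    obtain ⟨C, f, s, hCn, huC, hvC, hup, hcol, hinj⟩ := ih (by omega)
    -- every vertex outside an up-closed set has a neighbour outside
    have hout : ∀ C' : Finset V, u ∉ C' → v ∉ C' →
        (∀ x ∈ C', ∀ y, y ≠ u → y ≠ v → S.G.dist u x < S.G.dist u y → y ∈ C') →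
        ∀ w, w ∉ C' → ∃ w', w' ∉ C' ∧ S.G.Adj w w' := by
      intro C' hu hv hup w hw
      by_cases hwu : w = u
      · exact ⟨v, hv, hwu ▸ huv⟩
      by_cases hwv : w = v
      · exact ⟨u, hu, hwv ▸ huv.symm⟩
      obtain ⟨p, hp⟩ := hc.exists_walk_length_eq_dist w u
      cases p with
      | nil => exact absurd rfl hwu
      | @cons _ w' _ h q =>
        refine ⟨w', fun hw' => hw (hup w' hw' w hwu hwv ?_), h⟩
        have h1 := S.G.dist_le q
        rw [Walk.length_cons] at hp
        rw [S.G.dist_comm (u := u), S.G.dist_comm (u := u) (v := w)]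
        omega
    -- the next vertex
    obtain ⟨x, hx, hmax⟩ : ∃ x ∈ Finset.univ \ (insert u (insert v C)),
        ∀ y ∈ Finset.univ \ (insert u (insert v C)), S.G.dist u y ≤ S.G.dist u x := by
      apply Finset.exists_max_image
      apply Finset.card_pos.1
      have h1 := Finset.le_card_sdiff (insert u (insert v C)) Finset.univ
      have h2 := Finset.card_insert_le u (insert v C)
      have h3 := Finset.card_insert_le v C
      rw [Finset.card_univ] at h1
      omega
    have hxu : x ≠ u := by rintro rfl; simp at hx
    have hxv : x ≠ v := by rintro rfl; simp at hx
    have hxC : x ∉ C := by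
      intro h
      simp [h] at hx
    have huC' : u ∉ insert x C := by simp [huC, hxu.symm]
    have hvC' : v ∉ insert x C := by simp [hvC, hxv.symm]
    have hup' : ∀ z ∈ insert x C, ∀ y, y ≠ u → y ≠ v → S.G.dist u z < S.G.dist u y →
        y ∈ insert x C := by
      intro z hz y hyu hyv hlt
      rcases Finset.mem_insert.1 hz with rfl | hz
      · by_contra hy
        have hyC : y ∉ C := fun h => hy (Finset.mem_insert_of_mem h)
        have := hmax y (by simp [hyu, hyv, hyC])
        omega
      · exact Finset.mem_insert_of_mem (hup z hz y hyu hyv hlt)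
    -- coloured and uncoloured neighbours of `x`
    let NC := (S.G.neighborFinset x).filter (· ∈ C)
    let NU := (S.G.neighborFinset x).filter (· ∉ C)
    have hNsum : NC.card + NU.card ≤ k + 1 := by
      have := Finset.card_filter_add_card_filter_not (s := S.G.neighborFinset x) (· ∈ C)
      have h2 := hdeg x
      simp only [NC, NU]
      omega
    have hNU : 1 ≤ NU.card := by
      obtain ⟨w', hw', hadj⟩ := hout C huC hvC hup x hxC
      exact Finset.card_pos.2 ⟨w', by simp [NU, hw', hadj]⟩
    have hmemNC : ∀ y, y ∈ NC ↔ S.G.Adj x y ∧ y ∈ C := by intro y; simp [NC]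
    have hmemNU : ∀ y, y ∈ NU ↔ S.G.Adj x y ∧ y ∉ C := by intro y; simp [NU]
    have hinjNC : Set.InjOn f (NC : Set V) := by
      intro y hy z hz h
      have hy' := (hmemNC y).1 hy
      have hz' := (hmemNC z).1 hz
      exact hinj x hxC y hy'.2 z hz'.2 hy'.1 hz'.1 h
    let A := NC.image f
    have hAcard : A.card = NC.card := Finset.card_image_of_injOn hinjNC
    let α : Fin N → Bool := fun c =>
      if h : ∃ y ∈ NC, f y = c then (s h.choose ^^ S.sign x h.choose) else true
    have hα : ∀ y ∈ NC, α (f y) = (s y ^^ S.sign x y) := by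
      intro y hy
      have hex : ∃ z ∈ NC, f z = f y := ⟨y, hy, rfl⟩
      have h1 : hex.choose = y := hinjNC hex.choose_spec.1 hy hex.choose_spec.2
      simp only [α]
      rw [dif_pos hex, h1]
    let Q : V → Finset V := fun w => (S.G.neighborFinset w).filter (· ∈ C)
    have hQ : ∀ w ∈ NU, (Q w).card ≤ k - 1 := by
      intro w hw
      obtain ⟨hxw, hwC⟩ := (hmemNU w).1 hw
      have hwx : w ≠ x := hxw.ne'
      obtain ⟨w', hw', hadj⟩ := hout (insert x C) huC' hvC' hup' w (by simp [hwx, hwC])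
      have hw'x : w' ≠ x := fun h => hw' (by simp [h])
      have hw'C : w' ∉ C := fun h => hw' (by simp [h])
      have hsub : insert w' (insert x (Q w)) ⊆ S.G.neighborFinset w := by
        intro y hy
        rcases Finset.mem_insert.1 hy with rfl | hy
        · simpa using hadj
        rcases Finset.mem_insert.1 hy with rfl | hy
        · simpa using hxw.symm
        exact (Finset.mem_filter.1 hy).1
      have h1 := (Finset.card_le_card hsub).trans (hdeg w)
      rw [Finset.card_insert_of_notMem (by simp [Q, hw'x, hw'C]),
        Finset.card_insert_of_notMem (by simp [Q, hxC])] at h1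
      omega
    let F := (NU.biUnion Q).image f
    have hF : F.card ≤ (k + 1 - A.card) * (k - 1) := by
      calc F.card ≤ (NU.biUnion Q).card := Finset.card_image_le
        _ ≤ NU.card * (k - 1) := Finset.card_biUnion_le_card_mul _ _ _ hQ
        _ ≤ (k + 1 - A.card) * (k - 1) := Nat.mul_le_mul_right _ (by omega)
    obtain ⟨c, hcA, hcF, ε, hcε⟩ := aux_extend' k hk N hkN τ hτ A α F (by omega) hF
    have hfx : Function.update f x c x = c := Function.update_self ..
    have hsx : Function.update s x ε x = ε := Function.update_self ..
    have hfne : ∀ y ∈ C, Function.update f x c y = f y := fun y hy =>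
      Function.update_of_ne (fun h : y = x => hxC (h ▸ hy)) _ _
    have hsne : ∀ y ∈ C, Function.update s x ε y = s y := fun y hy =>
      Function.update_of_ne (fun h : y = x => hxC (h ▸ hy)) _ _
    have hnew : ∀ y ∈ C, S.G.Adj x y → c ≠ f y ∧ τ s(c, f y) = ((ε == s y) == S.sign x y) := by
      intro y hy hxy
      have hyN : y ∈ NC := (hmemNC y).2 ⟨hxy, hy⟩
      have hyA : f y ∈ A := Finset.mem_image_of_mem f hyN
      refine ⟨fun h => hcA (h ▸ hyA), ?_⟩
      rw [hcε _ hyA, hα y hyN]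
      cases ε <;> cases s y <;> cases S.sign x y <;> rfl
    have hnew2 : ∀ w, w ∉ insert x C → ∀ y ∈ C, S.G.Adj w x → S.G.Adj w y → c ≠ f y := by
      intro w hw y hy hwx hwy h
      apply hcF
      rw [h]
      apply Finset.mem_image_of_mem
      rw [Finset.mem_biUnion]
      exact ⟨w, (hmemNU w).2 ⟨hwx.symm, fun h => hw (Finset.mem_insert_of_mem h)⟩,
        by simp [Q, hwy, hy]⟩
    refine ⟨insert x C, Function.update f x c, Function.update s x ε, ?_, huC', hvC', hup', ?_, ?_⟩
    · rw [Finset.card_insert_of_notMem hxC, hCn]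
    · intro y hy0 z hz0 hyz
      rcases Finset.mem_insert.1 hy0 with rfl | hy
      · rcases Finset.mem_insert.1 hz0 with rfl | hz
        · exact absurd hyz (S.G.irrefl)
        · rw [hfx, hsx, hfne z hz, hsne z hz]
          exact hnew z hz hyz
      · rcases Finset.mem_insert.1 hz0 with rfl | hz
        · rw [hfx, hsx, hfne y hy, hsne y hy]
          obtain ⟨h1, h2⟩ := hnew y hy hyz.symm
          refine ⟨h1.symm, ?_⟩
          rw [Sym2.eq_swap, h2, S.sign_symm y z]
          cases ε <;> cases s y <;> rfl
        · rw [hfne y hy, hsne y hy, hfne z hz, hsne z hz]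
          exact hcol y hy z hz hyz
    · intro w hw y hy0 z hz0 hwy hwz hf
      rcases Finset.mem_insert.1 hy0 with rfl | hy
      · rcases Finset.mem_insert.1 hz0 with rfl | hz
        · rfl
        · rw [hfx, hfne z hz] at hf
          exact absurd hf (hnew2 w hw z hz hwy hwz)
      · rcases Finset.mem_insert.1 hz0 with rfl | hz
        · rw [hfx, hfne y hy] at hf
          exact absurd hf.symm (hnew2 w hw y hy hwz hwy)
        · rw [hfne y hy, hfne z hz] at hf
          exact hinj w (fun h => hw (Finset.mem_insert_of_mem h)) y hy z hz hwy hwz hf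

open Classical in
theorem aux_upper (k : ℕ) (hk : 28 ≤ k) {V : Type} [Fintype V] (S : SignedGraph V)
    (hc : S.G.Connected) (hdeg : ∀ v : V, (S.G.neighborFinset v).card ≤ k + 1) :
    chromS S ≤ (k - 2) * k * 2 ^ k + 2 := by
  set N := (k - 2) * k * 2 ^ k with hN
  have hkN : k < N := by
    have h1 : k < 2 ^ k := Nat.lt_two_pow_self
    have h2 : 0 < (k - 2) * k := Nat.mul_pos (by omega) (by omega)
    calc k < 2 ^ k := h1
      _ ≤ (k - 2) * k * 2 ^ k := Nat.le_mul_of_pos_left _ h2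
  obtain ⟨τ, hτ⟩ := aux_exists_signing k hk N hN
  have hcardW : Fintype.card (Fin N ⊕ Bool) = N + 2 := by simp
  by_cases hedge : ∃ u v, S.G.Adj u v
  swap
  · refine aux_chromS_le (W := Fin N ⊕ Bool) S _ hcardW (fun _ _ => true) (fun _ _ => rfl)
      (fun _ => Sum.inr true) (fun _ => true) fun u v huv => absurd ⟨u, v, huv⟩ hedge
  obtain ⟨u, v, huv⟩ := hedge
  have hne : u ≠ v := huv.ne
  have hcard2 : 2 ≤ Fintype.card V := by
    have := Finset.card_le_card (Finset.subset_univ ({u, v} : Finset V))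
    rwa [Finset.card_pair hne] at this
  obtain ⟨C, f, s, hCn, huC, hvC, -, hcol, hinj⟩ :=
    aux_greedy S hc k hk hdeg N hkN τ hτ u v huv (Fintype.card V - 2) (by omega)
  have hall : ∀ x, x ≠ u → x ≠ v → x ∈ C := by
    intro x hxu hxv
    by_contra hx
    have h1 : (insert x (insert u (insert v C))).card ≤ Fintype.card V := Finset.card_le_univ _
    rw [Finset.card_insert_of_notMem (by simp [hxu, hxv, hx]),
      Finset.card_insert_of_notMem (by simp [hne, huC]), Finset.card_insert_of_notMem hvC] at h1
    omega
  let p : Bool → V := fun b => if b then v else u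
  have hpC : ∀ b, p b ∉ C := by intro b; cases b <;> simp [p, huC, hvC]
  let g : Bool → Fin N → Bool := fun b c =>
    if h : ∃ y, y ∈ C ∧ S.G.Adj (p b) y ∧ f y = c then
      ((true == s h.choose) == S.sign (p b) h.choose) else true
  have hg : ∀ b y, y ∈ C → S.G.Adj (p b) y →
      g b (f y) = ((true == s y) == S.sign (p b) y) := by
    intro b y hy hadj
    have hex : ∃ z, z ∈ C ∧ S.G.Adj (p b) z ∧ f z = f y := ⟨y, hy, hadj, rfl⟩
    have h1 : hex.choose = y := hinj (p b) (hpC b) _ hex.choose_spec.1 _ hy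
      hex.choose_spec.2.1 hadj hex.choose_spec.2.2
    simp only [g]
    rw [dif_pos hex, h1]
  let τ' : Fin N ⊕ Bool → Fin N ⊕ Bool → Bool := fun a b =>
    match a, b with
    | .inl c, .inl d => τ s(c, d)
    | .inl c, .inr b => g b c
    | .inr b, .inl c => g b c
    | .inr _, .inr _ => S.sign u v
  let F : V → Fin N ⊕ Bool := fun x =>
    if x = u then .inr false else if x = v then .inr true else .inl (f x)
  let s' : V → Bool := fun x => if x ∈ C then s x else true
  have hFp : ∀ b, F (p b) = .inr b := by
    intro b; cases b <;> simp [F, p, hne.symm]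
  have hFC : ∀ x ∈ C, F x = .inl (f x) := by
    intro x hx
    have h1 : x ≠ u := fun h => huC (h ▸ hx)
    have h2 : x ≠ v := fun h => hvC (h ▸ hx)
    simp [F, h1, h2]
  have hsp : ∀ b, s' (p b) = true := by intro b; simp [s', hpC]
  have hsC : ∀ x ∈ C, s' x = s x := by intro x hx; simp [s', hx]
  have hcase : ∀ x, x ∈ C ∨ ∃ b, x = p b := by
    intro x
    by_cases h1 : x = u
    · exact Or.inr ⟨false, by simp [p, h1]⟩
    by_cases h2 : x = v
    · exact Or.inr ⟨true, by simp [p, h2]⟩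
    exact Or.inl (hall x h1 h2)
  refine aux_chromS_le (W := Fin N ⊕ Bool) S _ hcardW τ' ?_ F s' ?_
  · rintro (a | a) (b | b)
    · simp only [τ']; rw [Sym2.eq_swap]
    · rfl
    · rfl
    · rfl
  · intro x y hxy
    rcases hcase x with hx | ⟨b, rfl⟩ <;> rcases hcase y with hy | ⟨b', rfl⟩
    · rw [hFC x hx, hFC y hy, hsC x hx, hsC y hy]
      obtain ⟨h1, h2⟩ := hcol x hx y hy hxy
      exact ⟨fun h => h1 (Sum.inl.inj h), h2⟩
    · rw [hFC x hx, hFp, hsC x hx, hsp]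
      refine ⟨by simp, ?_⟩
      show g b' (f x) = _
      rw [hg b' x hx hxy.symm, S.sign_symm x]
      cases s x <;> rfl
    · rw [hFC y hy, hFp, hsC y hy, hsp]
      exact ⟨by simp, hg b y hy hxy⟩
    · rw [hFp, hFp, hsp, hsp]
      have hbb : b ≠ b' := by
        rintro rfl
        exact S.G.irrefl hxy
      refine ⟨fun h => hbb (Sum.inr.inj h), ?_⟩
      show S.sign u v = _
      cases b <;> cases b' <;> simp [p] at hbb ⊢
      exact S.sign_symm u v

end SignedGraph

open SignedGraph in
/-- Bounds on the signed chromatic number of connected graphs with maximum degree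
at most `Δ`, for `Δ ≥ 29`. -/
theorem chromS_boundedDegree (Δ : ℕ) (hΔ : 29 ≤ Δ) :
    (∀ (V : Type) [Fintype V], ∀ S : SignedGraph V, S.G.Connected →
        (∀ v : V, (S.G.neighborSet v).ncard ≤ Δ) →
        chromS S ≤ (Δ - 3) * (Δ - 1) * 2 ^ (Δ - 1) + 2) ∧
    (∃ (m : ℕ) (S : SignedGraph (Fin m)), S.G.Connected ∧
        (∀ v, (S.G.neighborSet v).ncard ≤ Δ) ∧
        2 ^ (Δ - 2) ≤ (chromS S) ^ 2) := by
  classical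
  refine ⟨fun V _ S hc hdeg => ?_, aux_lower Δ hΔ⟩
  have h := aux_upper (Δ - 1) (by omega) S hc (fun v => by
    have := hdeg v
    rw [← Nat.card_coe_set_eq, Nat.card_eq_fintype_card, card_neighborSet_eq_degree] at this
    rw [card_neighborFinset_eq_degree]
    convert this using 1
    omega)
  rwa [show Δ - 1 - 2 = Δ - 3 by omega] at h
end
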